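/- Abstract item (i)/(ii) of the iterated cohomology theorem: let C^{k,p} be a bicomplex (s of bidegree (1,0), d of bidegree (0,1), anticommuting, square-zero) such that for p < n every d-closed element of C^{k,p} decomposes as c = r + dξ with r ∈ R^{0,p} ⊆ C^{0,p}, where the subspace R^{*,*} (the 'closed forms on X') is annihilated by s, contains no nonzero s-exact elements, and R^{0,p} ∩ d(C^{0,p-1}) realizes the image of exact forms. Then the iterated cohomology H^{k,p}(s|d) vanishes for all k ≠ 0 and p < n, and H^{0,p}(s|d) is isomorphic to R^{0,p} modulo d-exact elements (i.e., to H^p(X)). -/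

import Mathlib

/-- A bicomplex of real vector spaces concentrated in form degrees `0 ≤ p ≤ n`,
graded by ghost number `k ∈ ℤ` and form degree `p`, with differentials `s` of
bidegree `(1,0)` and `d` of bidegree `(0,1)` satisfying `s² = 0`, `d² = 0`,
`sd + ds = 0`. -/
structure Bicomplex (n : ℕ) where
  C : ℤ → ℤ → Type
  addCommGroup : ∀ k p, AddCommGroup (C k p)
  module : ∀ k p, Module ℝ (C k p)
  s : ∀ k p, C k p →ₗ[ℝ] C (k + 1) p
  d : ∀ k p, C k p →ₗ[ℝ] C k (p + 1)
  triv : ∀ k p, (p < 0 ∨ (n : ℤ) < p) → Subsingleton (C k p)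
  ss : ∀ k p (x : C k p), s (k + 1) p (s k p x) = 0
  dd : ∀ k p (x : C k p), d k (p + 1) (d k p x) = 0
  sd : ∀ k p (x : C k p), s k (p + 1) (d k p x) + d (k + 1) p (s k p x) = 0

attribute [instance] Bicomplex.addCommGroup Bicomplex.module

namespace Bicomplex

variable {n : ℕ} (B : Bicomplex n)

/-- Transport along equalities of the bidegrees. -/
def cast {k k' p p' : ℤ} (hk : k = k') (hp : p = p') : B.C k p →ₗ[ℝ] B.C k' p' := by
  subst hk; subst hp; exact LinearMap.id

/-- The total complex in total degree `m`: the (finite, by triviality outside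
`0 ≤ p ≤ n`) direct sum of the `C (m - p) p`. -/
def Tot (m : ℤ) : Type := ∀ p : ℤ, B.C (m - p) p

instance (m : ℤ) : AddCommGroup (B.Tot m) :=
  inferInstanceAs (AddCommGroup (∀ p : ℤ, B.C (m - p) p))

instance (m : ℤ) : Module ℝ (B.Tot m) :=
  inferInstanceAs (Module ℝ (∀ p : ℤ, B.C (m - p) p))

/-- The total differential `s̃ = s + d` on the total complex. -/
def sTot (m : ℤ) : B.Tot m →ₗ[ℝ] B.Tot (m + 1) :=
  LinearMap.pi fun p =>
    ((B.cast (show m - p + 1 = m + 1 - p by ring) rfl).comp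
        ((B.s (m - p) p).comp
          (LinearMap.proj (φ := fun q : ℤ => B.C (m - q) q) p)))
    + ((B.cast (show m - (p - 1) = m + 1 - p by ring) (show p - 1 + 1 = p by ring)).comp
        ((B.d (m - (p - 1)) (p - 1)).comp
          (LinearMap.proj (φ := fun q : ℤ => B.C (m - q) q) (p - 1))))

/-- Transport along an equality of total degrees. -/
def castTot {m m' : ℤ} (h : m = m') : B.Tot m →ₗ[ℝ] B.Tot m' := by
  subst h; exact LinearMap.id

/-- Cocycles of the total complex. -/
def totClosed (m : ℤ) : Submodule ℝ (B.Tot m) := LinearMap.ker (B.sTot m)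

/-- Coboundaries of the total complex. -/
def totExact (m : ℤ) : Submodule ℝ (B.Tot m) :=
  LinearMap.range ((B.castTot (show m - 1 + 1 = m by ring)).comp (B.sTot (m - 1)))

/-- Cohomology of the total complex `(⊕_{k+p=m} C^{k,p}, s + d)` in total degree `m`. -/
def Htot (m : ℤ) :=
  B.totClosed m ⧸ ((B.totExact m).comap (B.totClosed m).subtype)

instance (m : ℤ) : AddCommGroup (B.Htot m) :=
  inferInstanceAs (AddCommGroup (B.totClosed m ⧸ ((B.totExact m).comap (B.totClosed m).subtype)))

instance (m : ℤ) : Module ℝ (B.Htot m) :=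
  inferInstanceAs (Module ℝ (B.totClosed m ⧸ ((B.totExact m).comap (B.totClosed m).subtype)))

/-- Elements `ω ∈ C^{k,n}` such that `s ω` is `d`-exact. -/
def iterClosed (k : ℤ) : Submodule ℝ (B.C k n) :=
  (LinearMap.range ((B.cast rfl (show (n : ℤ) - 1 + 1 = (n : ℤ) by ring)).comp
      (B.d (k + 1) ((n : ℤ) - 1)))).comap (B.s k n)

/-- Elements of the form `s ψ + d ξ` in `C^{k,n}` (`d ψ = 0` holds automatically in top
form degree `n`). -/
def iterBdry (k : ℤ) : Submodule ℝ (B.C k n) :=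
  LinearMap.range ((B.cast (show k - 1 + 1 = k by ring) rfl).comp (B.s (k - 1) n))
    ⊔ LinearMap.range ((B.cast rfl (show (n : ℤ) - 1 + 1 = (n : ℤ) by ring)).comp
        (B.d k ((n : ℤ) - 1)))

/-- The iterated cohomology `H^{k,n}(s|d)`. -/
def Hiter (k : ℤ) :=
  B.iterClosed k ⧸ ((B.iterBdry k).comap (B.iterClosed k).subtype)

instance (k : ℤ) : AddCommGroup (B.Hiter k) :=
  inferInstanceAs (AddCommGroup (B.iterClosed k ⧸ ((B.iterBdry k).comap (B.iterClosed k).subtype)))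

instance (k : ℤ) : Module ℝ (B.Hiter k) :=
  inferInstanceAs (Module ℝ (B.iterClosed k ⧸ ((B.iterBdry k).comap (B.iterClosed k).subtype)))

end Bicomplex

namespace Bicomplex

variable {n : ℕ} (B : Bicomplex n)

/-- `d`-closed elements `ω ∈ C^{k,p}` such that `s ω` is `d`-exact. -/
def iterClosedGen (k p : ℤ) : Submodule ℝ (B.C k p) :=
  LinearMap.ker (B.d k p) ⊓
    (LinearMap.range ((B.cast rfl (show p - 1 + 1 = p by ring)).comp
        (B.d (k + 1) (p - 1)))).comap (B.s k p)

/-- Elements of the form `s ψ + d ξ` with `ψ` a `d`-closed element of `C^{k-1,p}`. -/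
def iterBdryGen (k p : ℤ) : Submodule ℝ (B.C k p) :=
  (LinearMap.ker (B.d (k - 1) p)).map
      ((B.cast (show k - 1 + 1 = k by ring) rfl).comp (B.s (k - 1) p))
    ⊔ LinearMap.range ((B.cast rfl (show p - 1 + 1 = p by ring)).comp (B.d k (p - 1)))

/-- The iterated cohomology group `H^{k,p}(s|d)`. -/
def HiterGen (k p : ℤ) :=
  B.iterClosedGen k p ⧸ ((B.iterBdryGen k p).comap (B.iterClosedGen k p).subtype)

instance (k p : ℤ) : AddCommGroup (B.HiterGen k p) :=
  inferInstanceAs (AddCommGroup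
    (B.iterClosedGen k p ⧸ ((B.iterBdryGen k p).comap (B.iterClosedGen k p).subtype)))

instance (k p : ℤ) : Module ℝ (B.HiterGen k p) :=
  inferInstanceAs (Module ℝ
    (B.iterClosedGen k p ⧸ ((B.iterBdryGen k p).comap (B.iterClosedGen k p).subtype)))

end Bicomplex

namespace Bicomplex

variable {n : ℕ} (B : Bicomplex n)

/-- `s` and `d` anticommute, up to transport of the bidegrees. -/
theorem cast_s_cast_d {k k' p p' : ℤ} (hk : k + 1 = k') (hp : p + 1 = p') (η : B.C k p) :
    B.cast hk rfl (B.s k p' (B.cast rfl hp (B.d k p η))) =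
      B.cast rfl hp (B.d k' p (-B.cast hk rfl (B.s k p η))) := by
  subst hk hp
  rw [map_neg]
  exact eq_neg_of_add_eq_zero_left (B.sd k p η)

/-- If every `d`-closed element of bidegree `(k - 1, p)` is `d`-exact, the elements `s ψ + d ξ`
with `d ψ = 0` are exactly the `d`-exact ones. -/
theorem iterBdryGen_eq_range {k p : ℤ}
    (h : ∀ x : B.C (k - 1) p, B.d (k - 1) p x = 0 → ∃ ξ : B.C (k - 1) (p - 1),
      x = B.cast rfl (show p - 1 + 1 = p by ring) (B.d (k - 1) (p - 1) ξ)) :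
    B.iterBdryGen k p = LinearMap.range
      ((B.cast rfl (show p - 1 + 1 = p by ring)).comp (B.d k (p - 1))) := by
  refine sup_eq_right.2 (Submodule.map_le_iff_le_comap.2 fun ψ hψ => ?_)
  obtain ⟨η, rfl⟩ := h ψ hψ
  exact ⟨_, (B.cast_s_cast_d (show k - 1 + 1 = k by ring) (show p - 1 + 1 = p by ring) η).symm⟩

end Bicomplex

/-- **items (i)/(ii) of the iterated cohomology theorem, abstract form.**
Let `C^{k,p}` be a bicomplex (`s` of bidegree `(1,0)`, `d` of bidegree `(0,1)`,
anticommuting, square-zero) such that for `p < n` every `d`-closed element of `C^{k,p}`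
decomposes as `c = r + d ξ` with `r` in a distinguished subspace `R p ⊆ C^{0,p}`
("the closed forms on the base `X`", present only in ghost number `0`), where `R` consists
of `d`-closed elements, is annihilated by `s`, and contains no nonzero `s`-exact element.
Then the iterated cohomology `H^{k,p}(s|d)` vanishes for all `k ≠ 0` and `p < n`, and
`H^{0,p}(s|d)` is isomorphic to `R p` modulo `d`-exact elements (i.e. to `H^p(X)`). -/
theorem stmt_15 {n : ℕ} (B : Bicomplex n)
    (R : ∀ p : ℤ, Submodule ℝ (B.C 0 p))
    -- elements of R are d-closed and s-annihilated
    (hRd : ∀ (p : ℤ) (r : B.C 0 p), r ∈ R p → B.d 0 p r = 0)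
    (hRs : ∀ (p : ℤ) (r : B.C 0 p), r ∈ R p → B.s 0 p r = 0)
    -- no nonzero element of R is s-exact
    (hRnoexact : ∀ (p : ℤ) (r : B.C 0 p), r ∈ R p →
      (∃ ψ : B.C (-1) p, B.cast (show (-1 : ℤ) + 1 = 0 by ring) rfl (B.s (-1) p ψ) = r) →
      r = 0)
    -- in ghost number 0, every d-closed element splits as r + dξ with r ∈ R p
    (hdec0 : ∀ p : ℤ, 0 ≤ p → p < (n : ℤ) → ∀ x : B.C 0 p, B.d 0 p x = 0 →
      ∃ r ∈ R p, ∃ ξ : B.C 0 (p - 1),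
        x = r + B.cast rfl (show p - 1 + 1 = p by ring) (B.d 0 (p - 1) ξ))
    -- in nonzero ghost number, every d-closed element is d-exact
    (hdecne : ∀ k p : ℤ, 0 ≤ p → p < (n : ℤ) → k ≠ 0 → ∀ x : B.C k p, B.d k p x = 0 →
      ∃ ξ : B.C k (p - 1), x = B.cast rfl (show p - 1 + 1 = p by ring) (B.d k (p - 1) ξ)) :
    -- (i) H^{k,p}(s|d) = 0 for k ≠ 0, p < n
    (∀ k p : ℤ, k ≠ 0 → 0 ≤ p → p < (n : ℤ) → Subsingleton (B.HiterGen k p))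
    -- (ii) H^{0,p}(s|d) ≅ R p / (d-exact elements)  (= H^p(X))
    ∧ (∀ p : ℤ, 0 ≤ p → p < (n : ℤ) →
        Nonempty (B.HiterGen 0 p ≃ₗ[ℝ]
          (R p ⧸ ((LinearMap.range ((B.cast rfl (show p - 1 + 1 = p by ring)).comp
              (B.d 0 (p - 1)))).comap (R p).subtype)))) := by
  refine ⟨fun k p hk hp hpn => ?_, fun p hp hpn => ?_⟩
  · refine Submodule.Quotient.subsingleton_iff.2 (eq_top_iff.2 ?_)
    rintro ⟨x, hx⟩ -
    obtain ⟨ξ, rfl⟩ := hdecne k p hp hpn hk x hx.1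
    exact Submodule.mem_sup_right ⟨ξ, rfl⟩
  · have hbdry := B.iterBdryGen_eq_range (hdecne (0 - 1) p hp hpn (by norm_num))
    have hle : R p ≤ B.iterClosedGen 0 p := fun r hr =>
      ⟨hRd p r hr, 0, by rw [map_zero, hRs p r hr]⟩
    let f : R p →ₗ[ℝ] B.HiterGen 0 p :=
      (Submodule.mkQ ((B.iterBdryGen 0 p).comap (B.iterClosedGen 0 p).subtype)).comp
        (Submodule.inclusion hle)
    have hker : LinearMap.ker f = (LinearMap.range
        ((B.cast rfl (show p - 1 + 1 = p by ring)).comp (B.d 0 (p - 1)))).comap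
          (R p).subtype := by
      rw [← hbdry]
      ext r
      exact Submodule.Quotient.mk_eq_zero _
    have hsurj : Function.Surjective f := by
      intro y
      obtain ⟨⟨x, hx⟩, rfl⟩ := Submodule.mkQ_surjective _ y
      obtain ⟨r, hr, ξ, hξ⟩ := hdec0 p hp hpn x hx.1
      refine ⟨⟨r, hr⟩, ((Submodule.Quotient.eq _).2 ?_).symm⟩
      refine Submodule.mem_sup_right ⟨ξ, ?_⟩
      exact (sub_eq_of_eq_add' hξ).symm
    exact ⟨(Submodule.quotEquivOfEq _ _ hker.symm).trans
      (f.quotKerEquivOfSurjective hsurj) |>.symm⟩
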